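/- Let G be a finite group, μ : G → ℂ, ν : G → ℝ nonnegative, and C > 0 with |μ(g)| ≤ C·ν(g) for all g ∈ G. Suppose ε > 0 satisfies ε ≤ |G|^{-1/2} and for every φ : G → ℂ with ∑_{x ∈ G} φ(x) = 0 one has ‖ν ∗ φ‖₂ ≤ ε·‖ν‖₁·‖φ‖₂. Let A be the convolution operator φ ↦ μ ∗ φ, and let E be a subspace of the mean-zero functions invariant under A and A* such that every nonzero eigenvalue of A*A restricted to E has multiplicity at least m ≥ 1. Then for every φ ∈ E: ‖μ ∗ φ‖₂ ≤ √2·C·‖ν‖₁·m^{-1/4}·‖φ‖₂. -/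

import Mathlib

open scoped BigOperators ComplexConjugate

/-- Convolution of two functions on a finite group:
`(f ∗ g)(x) = ∑_y f(y)·g(y⁻¹x)`. -/
noncomputable def conv {G : Type*} [Group G] [Fintype G] (f g : G → ℂ) : G → ℂ :=
  fun x => ∑ y, f y * g (y⁻¹ * x)

/-- The ℓ¹ norm of a real-valued function. -/
noncomputable def norm1R {G : Type*} [Fintype G] (f : G → ℝ) : ℝ :=
  ∑ x, |f x|

/-- The ℓ² norm `‖f‖₂ = (∑_x |f(x)|²)^{1/2}`. -/
noncomputable def norm2 {G : Type*} [Fintype G] (f : G → ℂ) : ℝ :=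
  Real.sqrt (∑ x, ‖f x‖ ^ 2)

/-- The convolution operator `A : φ ↦ μ ∗ φ`, as a linear endomorphism of
`L²(G) = EuclideanSpace ℂ G` (whose inner product realizes
`⟨f, g⟩ = ∑_x f(x)·conj(g(x))` up to the conjugation convention, which yields
the same adjoint and the same eigenvalue multiplicities). -/
noncomputable def convMap {G : Type*} [Group G] [Fintype G] (μ : G → ℂ) :
    EuclideanSpace ℂ G →ₗ[ℂ] EuclideanSpace ℂ G where
  toFun φ := WithLp.toLp 2 (fun x => ∑ y, μ y * φ (y⁻¹ * x))
  map_add' φ ψ := by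
    ext x
    simp [mul_add, Finset.sum_add_distrib]
  map_smul' c φ := by
    ext x
    simp [Finset.mul_sum, mul_comm, mul_left_comm]

namespace DecouplingAux

variable {G : Type*} [Group G] [Fintype G]

lemma convMap_apply (μ : G → ℂ) (φ : EuclideanSpace ℂ G) (x : G) :
    convMap μ φ x = ∑ y, μ y * φ (y⁻¹ * x) := rfl

lemma norm2_eq (f : G → ℂ) : norm2 f = ‖(WithLp.toLp 2 f : EuclideanSpace ℂ G)‖ := by
  rw [EuclideanSpace.norm_eq]; rfl

lemma norm2_conv (f : G → ℂ) (φ : EuclideanSpace ℂ G) :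
    norm2 (conv f φ.ofLp) = ‖convMap f φ‖ := norm2_eq _

lemma adjoint_convMap (μ : G → ℂ) :
    LinearMap.adjoint (convMap μ) = convMap (fun y => conj (μ y⁻¹)) := by
  symm
  rw [LinearMap.eq_adjoint_iff]
  intro φ ψ
  simp only [PiLp.inner_apply, convMap_apply, RCLike.inner_apply, map_sum, map_mul,
    Complex.conj_conj, Finset.mul_sum, Finset.sum_mul]
  rw [Finset.sum_comm]
  conv_rhs => rw [Finset.sum_comm]
  rw [← Equiv.sum_comp (Equiv.inv G)]
  refine Finset.sum_congr rfl fun y _ => ?_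
  rw [← Equiv.sum_comp (Equiv.mulLeft y⁻¹)]
  refine Finset.sum_congr rfl fun x _ => ?_
  simp
  ring

lemma dom_step {μ : G → ℂ} {ρ : G → ℝ} (h : ∀ g, ‖μ g‖ ≤ ρ g)
    {f k : EuclideanSpace ℂ G} {r : G → ℝ} (hf : ∀ x, ‖f x‖ ≤ r x) (hk : ∀ x, k x = (r x : ℂ))
    (x : G) : ‖convMap μ f x‖ ≤ ∑ y, ρ y * r (y⁻¹ * x) ∧
      convMap (fun y => (ρ y : ℂ)) k x = ((∑ y, ρ y * r (y⁻¹ * x) : ℝ) : ℂ) := by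
  constructor
  · rw [convMap_apply]
    refine (norm_sum_le _ _).trans (Finset.sum_le_sum fun y _ => ?_)
    rw [norm_mul]
    exact mul_le_mul (h y) (hf _) (norm_nonneg _) ((norm_nonneg _).trans (h y))
  · rw [convMap_apply]
    push_cast
    exact Finset.sum_congr rfl fun y _ => by rw [hk]

/-- Domination of `A*A` on point masses. -/
lemma dom_two {μ : G → ℂ} {ρ : G → ℝ} (h : ∀ g, ‖μ g‖ ≤ ρ g)
    {f : EuclideanSpace ℂ G} {r : G → ℝ} (hf : ∀ x, f x = (r x : ℂ)) (hr : ∀ x, 0 ≤ r x) :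
    ‖LinearMap.adjoint (convMap μ) (convMap μ f)‖ ≤
      ‖LinearMap.adjoint (convMap (fun y => (ρ y : ℂ))) (convMap (fun y => (ρ y : ℂ)) f)‖ := by
  have h1 := dom_step h (f := f) (k := f) (r := r)
    (fun x => by rw [hf, Complex.norm_real, Real.norm_of_nonneg (hr x)]) hf
  have h2 := dom_step (μ := fun y => conj (μ y⁻¹)) (ρ := fun y => ρ y⁻¹)
    (fun g => by simpa using h g⁻¹) (fun x => (h1 x).1) (fun x => (h1 x).2)
  rw [adjoint_convMap, adjoint_convMap]
  rw [EuclideanSpace.norm_eq, EuclideanSpace.norm_eq]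
  refine Real.sqrt_le_sqrt (Finset.sum_le_sum fun x _ => ?_)
  refine pow_le_pow_left₀ (norm_nonneg _) ?_ 2
  have h3 := (h2 x).2
  simp only [Complex.conj_ofReal]
  rw [h3, Complex.norm_real]
  exact (h2 x).1.trans (le_abs_self _)

/-- The constant function one. -/
noncomputable def one (G : Type*) [Fintype G] : EuclideanSpace ℂ G := WithLp.toLp 2 (fun _ => 1)

lemma convMap_one (μ : G → ℂ) : convMap μ (one G) = (∑ y, μ y) • one G := by
  ext x
  simp [convMap_apply, one]

lemma inner_one (φ : EuclideanSpace ℂ G) : inner ℂ (one G) φ = ∑ x, φ x := by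
  simp [PiLp.inner_apply, one]

lemma adj_one (ν : G → ℝ) :
    LinearMap.adjoint (convMap fun y => (ν y : ℂ)) (one G) = (∑ y, (ν y : ℂ)) • one G := by
  rw [adjoint_convMap, convMap_one]
  congr 1
  rw [← Equiv.sum_comp (Equiv.inv G)]
  simp

lemma adj_gap (ν : G → ℝ) (K : ℝ)
    (hgap : ∀ φ : EuclideanSpace ℂ G, ∑ x, φ x = 0 →
      ‖convMap (fun x => (ν x : ℂ)) φ‖ ≤ K * ‖φ‖)
    (ψ : EuclideanSpace ℂ G) (hψ : ∑ x, ψ x = 0) :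
    ‖LinearMap.adjoint (convMap (fun x => (ν x : ℂ))) ψ‖ ≤ K * ‖ψ‖ := by
  set N := convMap (fun x => (ν x : ℂ)) with hN
  set χ := LinearMap.adjoint N ψ with hχ
  have h0 : ∑ x, χ x = 0 := by
    rw [← inner_one, hχ, LinearMap.adjoint_inner_right, hN, convMap_one, inner_smul_left,
      inner_one, hψ, mul_zero]
  have h1 : ‖χ‖ ^ 2 ≤ (K * ‖χ‖) * ‖ψ‖ := by
    have : (‖χ‖ : ℂ) ^ 2 = inner ℂ (N χ) ψ := by
      rw [← LinearMap.adjoint_inner_right, ← hχ]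
      exact (inner_self_eq_norm_sq_to_K χ).symm
    have h2 : ‖χ‖ ^ 2 = ‖inner ℂ (N χ) ψ‖ := by
      rw [← this]; simp
    rw [h2]
    exact (norm_inner_le_norm _ _).trans
      (mul_le_mul_of_nonneg_right (hgap χ h0) (norm_nonneg _))
  rcases (norm_nonneg χ).eq_or_lt with h | h
  · rw [← h]
    have h3 := (norm_nonneg _).trans (hgap ψ hψ)
    exact h3
  · nlinarith

lemma point_bound [DecidableEq G] (ν : G → ℝ) (s ε : ℝ) (hs : ∑ y, ν y = s) (hs0 : 0 ≤ s)
    (hε : 0 < ε) (hε' : ε ≤ 1 / Real.sqrt (Fintype.card G : ℝ))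
    (hgap : ∀ φ : EuclideanSpace ℂ G, ∑ x, φ x = 0 →
      ‖convMap (fun x => (ν x : ℂ)) φ‖ ≤ ε * s * ‖φ‖) (x : G) :
    ‖LinearMap.adjoint (convMap (fun x => (ν x : ℂ)))
      (convMap (fun x => (ν x : ℂ)) (EuclideanSpace.single x 1))‖ ≤
      2 * s ^ 2 / Real.sqrt (Fintype.card G : ℝ) := by
  set N := convMap (fun x => (ν x : ℂ)) with hN
  set n : ℝ := (Fintype.card G : ℝ) with hn
  have hn1 : 1 ≤ n := by
    rw [hn]; exact_mod_cast Fintype.card_pos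
  have hr1 : 1 ≤ Real.sqrt n := Real.one_le_sqrt.mpr hn1
  have hr2 : Real.sqrt n ^ 2 = n := Real.sq_sqrt (by linarith)
  have hsum : (∑ y, (ν y : ℂ)) = (s : ℂ) := by rw [← hs]; push_cast; rfl
  have hnorm1 : ‖one G‖ = Real.sqrt n := by
    rw [EuclideanSpace.norm_eq]; simp [one, hn]
  set c : ℂ := (n : ℂ)⁻¹ with hc
  have hcn : ‖c‖ = n⁻¹ := by
    rw [hc, norm_inv, Complex.norm_real, Real.norm_of_nonneg (by linarith)]
  have hnc : (n : ℂ) ≠ 0 := by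
    have : n ≠ 0 := by linarith
    exact_mod_cast this
  set δ : EuclideanSpace ℂ G := EuclideanSpace.single x 1 with hδ
  set ψ := δ - c • one G with hψ
  have hδsum : ∑ y, δ y = 1 := by simp [hδ, Finset.sum_ite_eq, Pi.single_apply]
  have h1s : ∑ y, (one G) y = (n : ℂ) := by simp [one, hn]
  have hψ0 : ∑ y, ψ y = 0 := by
    rw [← inner_one, hψ, inner_sub_right, inner_smul_right, inner_one, inner_one, hδsum, h1s, hc,
      inv_mul_cancel₀ hnc, sub_self]
  have hψn : ‖ψ‖ ≤ 1 := by
    have h2 : inner ℂ ψ (c • one G) = 0 := by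
      rw [inner_smul_right, ← inner_conj_symm, inner_one, hψ0]; simp
    have h3 := norm_add_sq_eq_norm_sq_add_norm_sq_of_inner_eq_zero ψ (c • one G) h2
    have h4 : ψ + c • one G = δ := by rw [hψ]; simp
    rw [h4] at h3
    have h5 : ‖δ‖ = 1 := by rw [hδ]; simp
    rw [h5] at h3
    nlinarith [norm_nonneg ψ, norm_nonneg (c • one G)]
  have hNψ0 : ∑ y, (N ψ) y = 0 := by
    rw [← inner_one, ← LinearMap.adjoint_inner_left, hN, adj_one, inner_smul_left, inner_one,
      hψ0, mul_zero]
  have hεs : 0 ≤ ε * s := by positivity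
  have hb1 : ‖LinearMap.adjoint N (N ψ)‖ ≤ (ε * s) * (ε * s) := by
    refine (adj_gap ν (ε * s) hgap _ hNψ0).trans (mul_le_mul_of_nonneg_left ?_ hεs)
    exact (hgap ψ hψ0).trans (mul_le_of_le_one_right hεs hψn)
  have hb2 : ‖LinearMap.adjoint N (N (c • one G))‖ = s ^ 2 / Real.sqrt n := by
    rw [map_smul, hN, convMap_one, map_smul, map_smul, adj_one, norm_smul, norm_smul, norm_smul,
      hsum, hcn, hnorm1, Complex.norm_real, Real.norm_of_nonneg hs0]
    have : Real.sqrt n ≠ 0 := by linarith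
    nth_rw 1 [← hr2]
    field_simp
  have hdec : δ = ψ + c • one G := by rw [hψ]; simp
  rw [hdec, map_add, map_add]
  refine (norm_add_le _ _).trans ?_
  rw [hb2]
  have he1 : ε * ε ≤ 1 / Real.sqrt n := by
    have : 1 / Real.sqrt n ≤ 1 := by
      rw [div_le_one (by linarith)]; exact hr1
    nlinarith
  have : (ε * s) * (ε * s) ≤ s ^ 2 / Real.sqrt n := by
    calc (ε * s) * (ε * s) = s ^ 2 * (ε * ε) := by ring
      _ ≤ s ^ 2 * (1 / Real.sqrt n) := mul_le_mul_of_nonneg_left he1 (sq_nonneg s)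
      _ = _ := by ring
  calc _ ≤ s ^ 2 / Real.sqrt n + s ^ 2 / Real.sqrt n := by linarith
    _ = _ := by ring

/-- Hilbert--Schmidt bound for an orthonormal family of eigenvectors. -/
lemma hs_bound [DecidableEq G] (S : EuclideanSpace ℂ G →ₗ[ℂ] EuclideanSpace ℂ G)
    (hS : S.IsSymmetric) {k : ℕ} (w : Fin k → EuclideanSpace ℂ G) (hw : Orthonormal ℂ w)
    (lam : ℝ) (hlam : ∀ j, S (w j) = (lam : ℂ) • w j) (B : ℝ)
    (hB : ∀ x, ‖S (EuclideanSpace.single x 1)‖ ^ 2 ≤ B) :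
    k * lam ^ 2 ≤ Fintype.card G * B := by
  have h1 : ∀ j, ∑ x, ‖inner ℂ (w j) (S (EuclideanSpace.single x 1))‖ ^ 2 = lam ^ 2 := by
    intro j
    have : ∀ x, inner ℂ (w j) (S (EuclideanSpace.single x 1)) = conj ((S (w j)) x) := by
      intro x
      rw [← hS, EuclideanSpace.inner_single_right]
      simp
    simp only [this, RCLike.norm_conj]
    rw [← EuclideanSpace.norm_sq_eq, hlam, norm_smul, hw.1 j, Complex.norm_real]
    simp
  have h2 : ∑ j : Fin k, ∑ x, ‖inner ℂ (w j) (S (EuclideanSpace.single x 1))‖ ^ 2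
      = k * lam ^ 2 := by
    simp [h1]
  rw [← h2, Finset.sum_comm]
  calc _ ≤ ∑ _x : G, B := Finset.sum_le_sum fun x _ =>
        (hw.sum_inner_products_le _).trans (hB x)
    _ = _ := by simp

/-- Quadratic form bound from a bound on the eigenvalues. -/
lemma quad_bound {F : Type*} [NormedAddCommGroup F] [InnerProductSpace ℂ F]
    [FiniteDimensional ℂ F] (S : F →ₗ[ℂ] F) (hS : S.IsSymmetric) (K : ℝ)
    (heig : ∀ lam : ℝ, Module.End.HasEigenvalue S (lam : ℂ) → lam ≤ K) (e : F) (q : ℝ)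
    (hq : (q : ℂ) = inner ℂ e (S e)) : q ≤ K * ‖e‖ ^ 2 := by
  have h2 : inner ℂ e (S e) = ((∑ i, hS.eigenvalues rfl i *
      ‖inner ℂ (hS.eigenvectorBasis rfl i) e‖ ^ 2 : ℝ) : ℂ) := by
    rw [← (hS.eigenvectorBasis rfl).sum_inner_mul_inner]
    push_cast
    refine Finset.sum_congr rfl fun i _ => ?_
    have h3 : inner ℂ (hS.eigenvectorBasis rfl i) (S e)
        = (hS.eigenvalues rfl i : ℂ) * inner ℂ (hS.eigenvectorBasis rfl i) e := by
      rw [← hS, hS.apply_eigenvectorBasis, inner_smul_left]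
      simp
    rw [h3, ← inner_conj_symm e (hS.eigenvectorBasis rfl i), mul_left_comm, RCLike.conj_mul]
    rfl
  have h3 : q = ∑ i, hS.eigenvalues rfl i *
      ‖inner ℂ (hS.eigenvectorBasis rfl i) e‖ ^ 2 := by
    exact_mod_cast hq.trans h2
  rw [h3, ← (hS.eigenvectorBasis rfl).sum_sq_norm_inner_right e, Finset.mul_sum]
  exact Finset.sum_le_sum fun i _ => mul_le_mul_of_nonneg_right
    (heig _ (hS.hasEigenvalue_eigenvalues rfl i)) (sq_nonneg _)

/-- An orthonormal family of eigenvectors. -/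
lemma exists_eigen {F : Type*} [NormedAddCommGroup F] [InnerProductSpace ℂ F]
    [FiniteDimensional ℂ F] (S : F →ₗ[ℂ] F) (lam : ℂ) :
    ∃ w : Fin (Module.finrank ℂ (Module.End.eigenspace S lam)) → F,
      Orthonormal ℂ w ∧ ∀ j, S (w j) = lam • w j :=
  ⟨fun j => stdOrthonormalBasis ℂ (Module.End.eigenspace S lam) j,
    (stdOrthonormalBasis ℂ (Module.End.eigenspace S lam)).orthonormal.comp_linearIsometry
      (Submodule.subtypeₗᵢ _),
    fun j => Module.End.mem_eigenspace_iff.mp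
      (stdOrthonormalBasis ℂ (Module.End.eigenspace S lam) j).2⟩

/-- Eigenvalue bound from multiplicity. -/
lemma eig_bound [DecidableEq G] (T : EuclideanSpace ℂ G →ₗ[ℂ] EuclideanSpace ℂ G)
    (hT : T.IsSymmetric) (E : Submodule ℂ (EuclideanSpace ℂ G)) (hE : ∀ φ ∈ E, T φ ∈ E)
    (D : ℝ) (hD : 0 ≤ D)
    (hpt : ∀ x, ‖T (EuclideanSpace.single x 1)‖ ≤ D / Real.sqrt (Fintype.card G : ℝ))
    (m : ℕ) (hm : 1 ≤ m) (lam : ℝ)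
    (hfin : m ≤ Module.finrank ℂ (Module.End.eigenspace (T.restrict hE) (lam : ℂ))) :
    lam ≤ D / Real.sqrt m := by
  have hn1 : (1 : ℝ) ≤ Fintype.card G := by exact_mod_cast Fintype.card_pos
  have hm1 : (1 : ℝ) ≤ m := by exact_mod_cast hm
  obtain ⟨w, hw, hwe⟩ := exists_eigen (F := E) (T.restrict hE) (lam : ℂ)
  have h2 := hs_bound T hT (fun j => (w j : EuclideanSpace ℂ G))
    (hw.comp_linearIsometry E.subtypeₗᵢ) lam (fun j => congrArg Subtype.val (hwe j)) _
    (fun x => pow_le_pow_left₀ (norm_nonneg _) (hpt x) 2)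
  have h3 : (Fintype.card G : ℝ) * (D / Real.sqrt (Fintype.card G : ℝ)) ^ 2 = D ^ 2 := by
    rw [div_pow, Real.sq_sqrt (by linarith)]
    field_simp
  rw [h3] at h2
  have h4 : (m : ℝ) * lam ^ 2 ≤ D ^ 2 := by
    refine le_trans (mul_le_mul_of_nonneg_right ?_ (sq_nonneg _)) h2
    exact_mod_cast hfin
  have h5 : lam ^ 2 ≤ (D / Real.sqrt m) ^ 2 := by
    rw [div_pow, Real.sq_sqrt (by linarith), le_div_iff₀ (by linarith)]
    linarith
  exact (abs_le_of_sq_le_sq' h5 (by positivity)).2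

/-- The abstract bound. -/
lemma op_bound [DecidableEq G] (A : EuclideanSpace ℂ G →ₗ[ℂ] EuclideanSpace ℂ G)
    (E : Submodule ℂ (EuclideanSpace ℂ G))
    (hE : ∀ φ ∈ E, (LinearMap.adjoint A ∘ₗ A) φ ∈ E)
    (D : ℝ) (hD : 0 ≤ D)
    (hpt : ∀ x, ‖LinearMap.adjoint A (A (EuclideanSpace.single x 1))‖ ≤
      D / Real.sqrt (Fintype.card G : ℝ))
    (m : ℕ) (hm : 1 ≤ m)
    (hmult : ∀ lam : ℂ, lam ≠ 0 →
      Module.End.HasEigenvalue ((LinearMap.adjoint A ∘ₗ A).restrict hE) lam →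
      m ≤ Module.finrank ℂ
        (Module.End.eigenspace ((LinearMap.adjoint A ∘ₗ A).restrict hE) lam))
    (φ : EuclideanSpace ℂ G) (hφ : φ ∈ E) :
    ‖A φ‖ ^ 2 ≤ D / Real.sqrt m * ‖φ‖ ^ 2 := by
  have hsymm : (LinearMap.adjoint A ∘ₗ A).IsSymmetric := by
    intro u v
    simp [LinearMap.adjoint_inner_left, LinearMap.adjoint_inner_right]
  refine quad_bound ((LinearMap.adjoint A ∘ₗ A).restrict hE) (fun u v => hsymm u v) _ ?_
    ⟨φ, hφ⟩ _ ?_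
  · intro lam hl
    by_cases h0 : lam = 0
    · rw [h0]; positivity
    · exact eig_bound _ hsymm E hE D hD hpt m hm lam (hmult _ (by exact_mod_cast h0) hl)
  · have : inner ℂ (⟨φ, hφ⟩ : E) ((LinearMap.adjoint A ∘ₗ A).restrict hE ⟨φ, hφ⟩)
        = inner ℂ φ (LinearMap.adjoint A (A φ)) := rfl
    rw [this, LinearMap.adjoint_inner_right]
    simp [inner_self_eq_norm_sq_to_K]

end DecouplingAux

open DecouplingAux in
/-- cf. Theorem `thm:main`: if `|μ| ≤ C·ν` pointwise, `ν` has
the spectral gap `‖ν ∗ φ‖₂ ≤ ε·‖ν‖₁·‖φ‖₂` on mean-zero `φ` for some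
`0 < ε ≤ |G|^{-1/2}`, and `E` is a subspace of mean-zero functions invariant
under `A : φ ↦ μ ∗ φ` and `A*`, on which every nonzero eigenvalue of `A*A`
has multiplicity at least `m ≥ 1`, then for every `φ ∈ E`:
`‖μ ∗ φ‖₂ ≤ √2·C·‖ν‖₁·m^{-1/4}·‖φ‖₂`. -/
theorem main_decoupling_bound
    {G : Type*} [Group G] [Fintype G]
    (μ : G → ℂ) (ν : G → ℝ) (hν : ∀ g, 0 ≤ ν g)
    (C : ℝ) (hC : 0 < C)
    (hdom : ∀ g, ‖μ g‖ ≤ C * ν g)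
    (ε : ℝ) (hε : 0 < ε) (hε' : ε ≤ 1 / Real.sqrt (Fintype.card G : ℝ))
    (hgap : ∀ φ : G → ℂ, (∑ x, φ x) = 0 →
      norm2 (conv (fun x => (ν x : ℂ)) φ) ≤ ε * norm1R ν * norm2 φ)
    (E : Submodule ℂ (EuclideanSpace ℂ G))
    (hE0 : ∀ φ ∈ E, (∑ x, φ x) = 0)
    (hAinv : ∀ φ ∈ E, convMap μ φ ∈ E)
    (hAadjinv : ∀ φ ∈ E, LinearMap.adjoint (convMap μ) φ ∈ E)
    (m : ℕ) (hm : 1 ≤ m)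
    (hmult : ∀ lam : ℂ, lam ≠ 0 →
      Module.End.HasEigenvalue
        ((LinearMap.adjoint (convMap μ) ∘ₗ convMap μ).restrict
          (fun φ hφ => hAadjinv _ (hAinv φ hφ))) lam →
      m ≤ Module.finrank ℂ
        (Module.End.eigenspace
          ((LinearMap.adjoint (convMap μ) ∘ₗ convMap μ).restrict
            (fun φ hφ => hAadjinv _ (hAinv φ hφ))) lam)) :
    ∀ φ ∈ E, norm2 (conv μ φ.ofLp) ≤
      Real.sqrt 2 * C * norm1R ν * (m : ℝ) ^ (-(1 : ℝ) / 4) * norm2 φ.ofLp := by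
  classical
  obtain ⟨s, hs⟩ : ∃ s, s = norm1R ν := ⟨_, rfl⟩
  simp only [← hs] at hgap ⊢
  have hs0 : 0 ≤ s := hs ▸ Finset.sum_nonneg fun x _ => abs_nonneg _
  have hsum : ∑ y, ν y = s := by
    rw [hs, norm1R]; exact Finset.sum_congr rfl fun x _ => (abs_of_nonneg (hν x)).symm
  have hgap' : ∀ φ : EuclideanSpace ℂ G, ∑ x, φ x = 0 →
      ‖convMap (fun x => (ν x : ℂ)) φ‖ ≤ ε * s * ‖φ‖ := by
    intro φ hφ
    have := hgap φ.ofLp hφ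
    rwa [norm2_conv, norm2_eq] at this
  have hn1 : (1 : ℝ) ≤ Fintype.card G := by exact_mod_cast Fintype.card_pos
  have hm1 : (1 : ℝ) ≤ m := by exact_mod_cast hm
  have hpt : ∀ x, ‖LinearMap.adjoint (convMap μ) (convMap μ (EuclideanSpace.single x 1))‖ ≤
      2 * (C * s) ^ 2 / Real.sqrt (Fintype.card G : ℝ) := by
    intro x
    refine (dom_two (ρ := fun y => C * ν y) hdom (r := Pi.single x 1) ?_ ?_).trans ?_
    · intro y
      by_cases h : y = x <;> simp [Pi.single_apply, h]
    · intro y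
      by_cases h : y = x <;> simp [Pi.single_apply, h]
    · refine point_bound (fun y => C * ν y) (C * s) ε ?_ (by positivity) hε hε' ?_ x
      · rw [← hsum, Finset.mul_sum]
      · intro φ hφ
        have h1 : convMap (fun x => ((C * ν x : ℝ) : ℂ)) φ
            = (C : ℂ) • convMap (fun x => (ν x : ℂ)) φ := by
          ext x
          simp [convMap_apply, Finset.mul_sum, mul_assoc]
        rw [h1, norm_smul, Complex.norm_real, Real.norm_of_nonneg hC.le]
        calc C * _ ≤ C * (ε * s * ‖φ‖) := mul_le_mul_of_nonneg_left (hgap' φ hφ) hC.le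
          _ = _ := by ring
  intro φ hφ
  rw [norm2_conv, norm2_eq]
  change ‖convMap μ φ‖ ≤ _ * ‖φ‖
  have hE : ∀ φ ∈ E, (LinearMap.adjoint (convMap μ) ∘ₗ convMap μ) φ ∈ E := by
    intro φ hφ
    rw [LinearMap.comp_apply]
    exact hAadjinv _ (hAinv φ hφ)
  have hD : 0 ≤ 2 * (C * s) ^ 2 := by positivity
  have hquad := op_bound (convMap μ) E hE (2 * (C * s) ^ 2) hD hpt m hm
  replace hquad := hquad hmult
  replace hquad := hquad φ hφ
  have hp : ((m : ℝ) ^ (-(1 : ℝ) / 4)) ^ 2 = 1 / Real.sqrt m := by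
    rw [← Real.rpow_natCast, ← Real.rpow_mul (by linarith), Real.sqrt_eq_rpow, one_div,
      ← Real.rpow_neg (by linarith)]
    norm_num
  refine (abs_le_of_sq_le_sq' (hquad.trans (le_of_eq ?_)) (by positivity)).2
  rw [mul_pow, mul_pow, mul_pow, mul_pow, mul_pow, hp, Real.sq_sqrt (by norm_num)]
  ring
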